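/- arXiv:1801.07559 — 7 statements merged into one kernel-verified Lean document; each statement's English description precedes it below -/
import Mathlib

section
/- Fix a prime p, let F := GaloisField p 2, let m ≥ 1 and A := F[X]/(X^m) with x ∈ A the residue class of X. Let ζ ∈ F be a primitive (p²−1)-th root of unity and let φ_ζ : A → A be an F-algebra homomorphism with φ_ζ(x) = ζ^{p−1}·x. If n is a natural number such that p+1 does not divide n, then x^n lies in the F-submodule of A spanned by the set {φ_ζ(a) − a : a ∈ A}. -/
open Polynomial

/-- If `φ` scales `x` by `c` and `c ^ n ≠ 1`, then `x ^ n` lies in the span of the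
elements `φ a - a`. -/
theorem AlgHom.pow_mem_span_sub_of_map_eq_smul {K A : Type*} [Field K] [Ring A] [Algebra K A]
    (φ : A →ₐ[K] A) {x : A} {c : K} (hx : φ x = c • x) {n : ℕ} (hc : c ^ n ≠ 1) :
    x ^ n ∈ Submodule.span K {y | ∃ a, y = φ a - a} := by
  have key : φ (x ^ n) - x ^ n = (c ^ n - 1) • x ^ n := by
    rw [map_pow, hx, _root_.smul_pow, sub_smul, one_smul]
  rw [← inv_smul_smul₀ (sub_ne_zero.mpr hc) (x ^ n), ← key]
  exact Submodule.smul_mem _ _ (Submodule.subset_span ⟨x ^ n, rfl⟩)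

/-- Let `F = 𝔽_{p²}`, `A = F[X]/(X^m)` with `x` the class of `X`, `ζ ∈ F` a primitive
`(p²-1)`-th root of unity, and `φ_ζ` an `F`-algebra endomorphism of `A` with
`φ_ζ(x) = ζ^{p-1}·x`.  If `p+1` does not divide `n`, then `x^n` lies in the `F`-span of
`{φ_ζ(a) - a : a ∈ A}`. -/
theorem pow_mem_span_of_not_dvd (p : ℕ) [Fact p.Prime] (m : ℕ) (hm : 1 ≤ m)
    (ζ : GaloisField p 2) (hζ : IsPrimitiveRoot ζ (p ^ 2 - 1))
    (φ : (Polynomial (GaloisField p 2) ⧸ Ideal.span {(X : Polynomial (GaloisField p 2)) ^ m})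
      →ₐ[GaloisField p 2]
      (Polynomial (GaloisField p 2) ⧸ Ideal.span {(X : Polynomial (GaloisField p 2)) ^ m}))
    (hφ : φ (Ideal.Quotient.mk _ X) = ζ ^ (p - 1) • Ideal.Quotient.mk _ X)
    (n : ℕ) (hn : ¬ (p + 1) ∣ n) :
    (Ideal.Quotient.mk (Ideal.span {(X : Polynomial (GaloisField p 2)) ^ m}) X) ^ n ∈
      Submodule.span (GaloisField p 2) {y | ∃ a, y = φ a - a} := by
  refine φ.pow_mem_span_sub_of_map_eq_smul hφ fun h => hn ?_
  have hp : 0 < p - 1 := Nat.sub_pos_of_lt (Fact.out : p.Prime).one_lt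
  have hfac : p ^ 2 - 1 = (p - 1) * (p + 1) := by
    simpa [mul_comm] using Nat.sq_sub_sq p 1
  rw [← pow_mul, hζ.pow_eq_one_iff_dvd, hfac] at h
  exact Nat.dvd_of_mul_dvd_mul_left hp h
end

section
/- Fix a prime p and let F := GaloisField p 2. Let α ≥ 1 be an integer with α not congruent to 1 modulo p, and set k := (p+1)·α. Let A := F[X]/(X^{k+1}) with x ∈ A the residue class of X. Let t₀ ∈ A be any element with t₀ ≡ 1 + x modulo the ideal (x^p), and let φ : A → A be an F-algebra homomorphism with φ(x) = t₀^{p−1}·x. Then x^k lies in the F-submodule of A spanned by the set {φ(a) − a : a ∈ A}. -/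
open Polynomial

/-- An element congruent to `1 + x` modulo `x ^ 2` has `n`-th power congruent to `1 + n x`. -/
lemma exists_pow_eq_one_add_mul_add_sq_mul {A : Type*} [CommRing A] {x t c : A}
    (ht : t = 1 + x + x ^ 2 * c) (n : ℕ) : ∃ d, t ^ n = 1 + n * x + x ^ 2 * d := by
  induction n with
  | zero => exact ⟨0, by simp⟩
  | succ n ih =>
    obtain ⟨d, hd⟩ := ih
    refine ⟨c + n + n * x * c + d + x * d + x ^ 2 * d * c, ?_⟩
    rw [pow_succ, hd, ht]
    push_cast
    ring

/-- If `φ x = t ^ n * x` with `t ≡ 1 + x` modulo `x ^ 2`, then `φ - 1` sends `x ^ m` to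
`n m x ^ (m + 1)` as soon as `x ^ (m + 2) = 0`. -/
lemma map_pow_sub_pow_of_map_eq {A G : Type*} [CommRing A] [FunLike G A A] [MonoidHomClass G A A]
    {φ : G} {x t c : A} {n m : ℕ} (ht : t = 1 + x + x ^ 2 * c) (hφ : φ x = t ^ n * x)
    (hx : x ^ (m + 2) = 0) : φ (x ^ m) - x ^ m = ((n * m : ℕ) : A) * x ^ (m + 1) := by
  obtain ⟨d, hd⟩ := exists_pow_eq_one_add_mul_add_sq_mul ht (n * m)
  rw [map_pow, hφ, mul_pow, ← pow_mul, hd]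
  linear_combination d * hx

/-- Let `F = 𝔽_{p²}`, `α ≥ 1` with `α ≢ 1 (mod p)`, `k = (p+1)α`, and
`A = F[X]/(X^{k+1})` with `x` the class of `X`.  If `t₀ ≡ 1 + x mod (x^p)` and `φ` is an
`F`-algebra endomorphism of `A` with `φ(x) = t₀^{p-1}·x`, then `x^k` lies in the `F`-span
of `{φ(a) - a : a ∈ A}`. -/
theorem pow_k_mem_span (p : ℕ) [Fact p.Prime] (α : ℕ) (hα : 1 ≤ α)
    (hα1 : ¬ α ≡ 1 [MOD p]) (k : ℕ) (hk : k = (p + 1) * α)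
    (t₀ : Polynomial (GaloisField p 2) ⧸
      Ideal.span {(X : Polynomial (GaloisField p 2)) ^ (k + 1)})
    (ht₀ : t₀ - (1 + Ideal.Quotient.mk _ X) ∈
      Ideal.span {(Ideal.Quotient.mk
        (Ideal.span {(X : Polynomial (GaloisField p 2)) ^ (k + 1)}) X) ^ p})
    (φ : (Polynomial (GaloisField p 2) ⧸
        Ideal.span {(X : Polynomial (GaloisField p 2)) ^ (k + 1)})
      →ₐ[GaloisField p 2]
      (Polynomial (GaloisField p 2) ⧸
        Ideal.span {(X : Polynomial (GaloisField p 2)) ^ (k + 1)}))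
    (hφ : φ (Ideal.Quotient.mk _ X) = t₀ ^ (p - 1) * Ideal.Quotient.mk _ X) :
    (Ideal.Quotient.mk (Ideal.span {(X : Polynomial (GaloisField p 2)) ^ (k + 1)}) X) ^ k ∈
      Submodule.span (GaloisField p 2) {y | ∃ a, y = φ a - a} := by
  have hp : p.Prime := Fact.out
  obtain ⟨m, rfl⟩ : ∃ m, k = m + 1 :=
    Nat.exists_eq_succ_of_ne_zero (hk ▸ (Nat.mul_pos p.succ_pos hα).ne')
  obtain ⟨c, hc⟩ := Ideal.mem_span_singleton'.1 ht₀
  have ht : t₀ = 1 + Ideal.Quotient.mk _ X + (Ideal.Quotient.mk _ X) ^ 2 *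
      (c * (Ideal.Quotient.mk _ X) ^ (p - 2)) := by
    rw [mul_left_comm, ← pow_add, Nat.add_sub_cancel' hp.two_le, hc]
    ring
  have hx : (Ideal.Quotient.mk
      (Ideal.span {(X : Polynomial (GaloisField p 2)) ^ (m + 1 + 1)}) X) ^ (m + 2) = 0 := by
    rw [← map_pow]
    exact Ideal.Quotient.eq_zero_iff_mem.2 (Ideal.mem_span_singleton_self _)
  have hm : ¬ p ∣ m := fun h => hα1 <| by
    have h₁ : (p + 1) * α ≡ 1 [MOD p] := by
      rw [← hk]
      exact ((Nat.modEq_zero_iff_dvd.2 h).add_right 1)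
    have h₂ : (p + 1) * α ≡ α [MOD p] := by
      simp [Nat.ModEq, add_mul]
    exact h₂.symm.trans h₁
  have hne : (((p - 1) * m : ℕ) : GaloisField p 2) ≠ 0 := by
    rw [Ne, CharP.cast_eq_zero_iff (GaloisField p 2) p, hp.dvd_mul, not_or]
    exact ⟨Nat.not_dvd_of_pos_of_lt (Nat.sub_pos_of_lt hp.one_lt) (Nat.pred_lt hp.ne_zero), hm⟩
  rw [← Submodule.smul_mem_iff _ hne]
  refine Submodule.subset_span ⟨(Ideal.Quotient.mk _ X) ^ m, ?_⟩
  rw [map_pow_sub_pow_of_map_eq ht hφ hx, ← nsmul_eq_mul]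
  exact Nat.cast_smul_eq_nsmul _ _ _
end

section
/- Let F := GaloisField 2 2 be the field with 4 elements. Let α ≥ 1 be an integer with α ≡ 1 modulo 4, and set k := 3α. Let A := F[X]/(X^{k+1}) with x the residue class of X. Let ζ ∈ F be a primitive cube root of unity and φ_ζ : A → A an F-algebra homomorphism with φ_ζ(x) = ζ·x. Let t ∈ A be any element with t ≡ 1 + x + x² + x⁴ modulo (x⁵), and let φ₁ : A → A be an F-algebra homomorphism with φ₁(x) = t·x. Then x^k lies in the F-submodule of A spanned by the set {σ(a) − a : σ ∈ {φ₁, φ_ζ}, a ∈ A}. -/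
open Polynomial Finset

/-- The truncated polynomial ring `F[X]/(X^k)` over `F = 𝔽₄`. -/
abbrev TruncPoly4 (k : ℕ) :=
  Polynomial (GaloisField 2 2) ⧸ Ideal.span {(X : Polynomial (GaloisField 2 2)) ^ k}

/-- The residue class of `X` in `F[X]/(X^k)`. -/
noncomputable abbrev truncX4 (k : ℕ) : TruncPoly4 k := Ideal.Quotient.mk _ X

theorem exists_pow_four_mul_add_one_eq {A : Type*} [CommRing A] (h2 : (2 : A) = 0) (x u : A)
    (j : ℕ) : ∃ r : A, (1 + x + x ^ 2 + x ^ 3 * u) ^ (4 * j + 1) = 1 + x + x ^ 2 + x ^ 3 * r := by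
  induction j with
  | zero => exact ⟨u, by simp⟩
  | succ j ih =>
    obtain ⟨r, hr⟩ := ih
    have h4 : ∀ a b : A, (a + b) ^ 4 = a ^ 4 + b ^ 4 := fun a b => by
      linear_combination (2 * a ^ 3 * b + 3 * a ^ 2 * b ^ 2 + 2 * a * b ^ 3) * h2
    refine ⟨r + (1 + x + x ^ 2 + x ^ 3 * r) * (x + x ^ 5 + x ^ 9 * u ^ 4), ?_⟩
    rw [show 4 * (j + 1) + 1 = (4 * j + 1) + 4 by ring, pow_add, hr, h4, h4, h4]
    ring

theorem truncX4_pow_self (n : ℕ) : truncX4 n ^ n = 0 := by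
  rw [← map_pow, Ideal.Quotient.eq_zero_iff_mem]
  exact Ideal.mem_span_singleton_self _

theorem two_eq_zero_truncPoly4 (n : ℕ) : (2 : TruncPoly4 n) = 0 := by
  have h : (2 : GaloisField 2 2) = 0 := CharTwo.two_eq_zero
  rw [← map_ofNat (algebraMap (GaloisField 2 2) (TruncPoly4 n)) 2, h, map_zero]

/-- Let `F = 𝔽₄`, `α ≥ 1` with `α ≡ 1 (mod 4)`, `k = 3α` and `A = F[X]/(X^{k+1})` with
`x` the class of `X`.  Let `φ_ζ` be the algebra map sending `x` to `ζ x` for a primitive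
cube root of unity `ζ`, and `φ₁` the algebra map with `φ₁(x) = t·x` where
`t ≡ 1 + x + x² + x⁴ mod (x⁵)`.  Then `x^k` lies in the `F`-span of
`{σ(a) - a : σ ∈ {φ₁, φ_ζ}, a ∈ A}`. -/
theorem pow_k_mem_span_two (α : ℕ) (hα : 1 ≤ α) (hα1 : α ≡ 1 [MOD 4])
    (k : ℕ) (hk : k = 3 * α)
    (ζ : GaloisField 2 2) (hζ : IsPrimitiveRoot ζ 3)
    (φζ : TruncPoly4 (k + 1) →ₐ[GaloisField 2 2] TruncPoly4 (k + 1))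
    (hφζ : φζ (truncX4 (k + 1)) = ζ • truncX4 (k + 1))
    (t : TruncPoly4 (k + 1))
    (ht : t - (1 + truncX4 (k + 1) + truncX4 (k + 1) ^ 2 + truncX4 (k + 1) ^ 4) ∈
      Ideal.span {truncX4 (k + 1) ^ 5})
    (φ₁ : TruncPoly4 (k + 1) →ₐ[GaloisField 2 2] TruncPoly4 (k + 1))
    (hφ₁ : φ₁ (truncX4 (k + 1)) = t * truncX4 (k + 1)) :
    truncX4 (k + 1) ^ k ∈
      Submodule.span (GaloisField 2 2)
        {y | ∃ σ ∈ ({φ₁, φζ} : Set (TruncPoly4 (k + 1) →ₐ[GaloisField 2 2] TruncPoly4 (k + 1))),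
          ∃ a, y = σ a - a} := by
  obtain ⟨j, hj⟩ : ∃ j, k = 4 * j + 3 := ⟨k / 4, by unfold Nat.ModEq at hα1; omega⟩
  have hk1 : ¬ 3 ∣ 4 * j + 2 := by omega
  have hx0 := truncX4_pow_self (k + 1)
  have h2 := two_eq_zero_truncPoly4 (k + 1)
  generalize truncX4 (k + 1) = x at *
  obtain ⟨v, hv⟩ := Ideal.mem_span_singleton.mp ht
  obtain ⟨r, hr⟩ := exists_pow_four_mul_add_one_eq h2 x (x + x ^ 2 * v) j
  have ht' : t = 1 + x + x ^ 2 + x ^ 3 * (x + x ^ 2 * v) := by linear_combination hv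
  rw [← ht'] at hr
  have hxj : x ^ k = x ^ (4 * j + 3) := congrArg (x ^ ·) hj
  have hxk : x ^ (4 * j + 4) = 0 := by rw [pow_succ, ← hxj, ← pow_succ, hx0]
  rw [hxj]
  have hζx : x ^ (4 * j + 2) ∈ Submodule.span (GaloisField 2 2)
      {y | ∃ σ ∈ ({φ₁, φζ} : Set (TruncPoly4 (k + 1) →ₐ[GaloisField 2 2] TruncPoly4 (k + 1))),
        ∃ a, y = σ a - a} := by
    have hne : ζ ^ (4 * j + 2) - 1 ≠ 0 :=
      sub_ne_zero.mpr fun h => hk1 ((hζ.pow_eq_one_iff_dvd _).mp h)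
    rw [← Submodule.smul_mem_iff _ hne]
    refine Submodule.subset_span ⟨φζ, by simp, x ^ (4 * j + 2), ?_⟩
    rw [map_pow, hφζ, _root_.smul_pow, sub_smul, one_smul]
  have hφx : φ₁ (x ^ (4 * j + 1)) - x ^ (4 * j + 1) = x ^ (4 * j + 2) + x ^ (4 * j + 3) := by
    rw [map_pow, hφ₁, mul_pow, hr]
    linear_combination r * hxk
  rw [← Submodule.add_mem_iff_right _ hζx, ← hφx]
  exact Submodule.subset_span ⟨φ₁, by simp, _, rfl⟩
end

section
/- Let F := GaloisField 2 2 be the field with 4 elements. Let ℓ ≥ 2 and let η be any non-negative integer. Set k := 3·(2^ℓ − 1 + 2^{ℓ+1}·η), and for 0 ≤ r ≤ ℓ−1 set k_r := 3·(2^ℓ − 2^r + 2^{ℓ+1}·η). Let A := F[X]/(X^{k+1}) with x the residue class of X. Let s ∈ A be any element with s ≡ 1 + x³ + x⁹ modulo (x^{10}), and let φ₂ : A → A be an F-algebra homomorphism with φ₂(x) = s·x. Then for every natural number r with r + 1 ≤ ℓ − 1, the element x^{k_r} − x^{k_{r+1}} lies in the F-submodule of A spanned by the set {φ₂(a) − a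 : a ∈ A}. -/
open Polynomial Finset

/-- If `2 = 0`, the shape `1 + y + y³z` is preserved by raising everything to the power `2^r`. -/
theorem pow_two_pow_of_eq_one_add {R : Type*} [CommRing R] (h2 : (2 : R) = 0) {s y : R}
    (hs : ∃ z, s = 1 + y + y ^ 3 * z) (r : ℕ) :
    ∃ z, s ^ 2 ^ r = 1 + y ^ 2 ^ r + (y ^ 2 ^ r) ^ 3 * z := by
  induction r with
  | zero => simpa using hs
  | succ r ih =>
    obtain ⟨z, hz⟩ := ih
    refine ⟨z ^ 2, ?_⟩
    rw [pow_succ 2 r, pow_mul, pow_mul, hz]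
    generalize y ^ 2 ^ r = w
    linear_combination (w + w ^ 3 * z + w ^ 4 * z) * h2

/-- If `2 = 0`, then `(1 + y + y³z)^(4n+3) ≡ 1 + y + y²` modulo `y³`. -/
theorem one_add_pow_four_mul_add_three {R : Type*} [CommRing R] (h2 : (2 : R) = 0) (y z : R)
    (n : ℕ) : ∃ d, (1 + y + y ^ 3 * z) ^ (4 * n + 3) = 1 + y + y ^ 2 + y ^ 3 * d := by
  induction n with
  | zero =>
    refine ⟨1 + z * (3 * (1 + y) ^ 2 + 3 * (1 + y) * (y ^ 3 * z) + (y ^ 3 * z) ^ 2), ?_⟩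
    linear_combination (y + y ^ 2) * h2
  | succ n ih =>
    obtain ⟨d, hd⟩ := ih
    have h4 : (1 + y + y ^ 3 * z) ^ 4 = 1 + y ^ 3 * (y + y ^ 9 * z ^ 4) := by
      have hsq (a b : R) : (a + b) ^ 2 = a ^ 2 + b ^ 2 := by linear_combination a * b * h2
      rw [show 4 = 2 * 2 from rfl, pow_mul, hsq, hsq, hsq, hsq]
      ring
    refine ⟨d + (1 + y + y ^ 2 + y ^ 3 * d) * (y + y ^ 9 * z ^ 4), ?_⟩
    rw [show 4 * (n + 1) + 3 = 4 * n + 3 + 4 by ring, pow_add, hd, h4]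
    ring

/-- Let `F = 𝔽₄`, `ℓ ≥ 2`, `η ≥ 0`, `k = 3(2^ℓ - 1 + 2^{ℓ+1}η)` and
`k_r = 3(2^ℓ - 2^r + 2^{ℓ+1}η)`.  Let `A = F[X]/(X^{k+1})` with `x` the class of `X`, and
let `φ₂` be the algebra map with `φ₂(x) = s·x` where `s ≡ 1 + x³ + x⁹ mod (x^{10})`.
Then for `r + 1 ≤ ℓ - 1`, the element `x^{k_r} - x^{k_{r+1}}` lies in the `F`-span of
`{φ₂(a) - a : a ∈ A}`. -/
theorem steps_two (ℓ : ℕ) (hℓ : 2 ≤ ℓ) (η : ℕ)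
    (k : ℕ) (hk : k = 3 * (2 ^ ℓ - 1 + 2 ^ (ℓ + 1) * η))
    (k' : ℕ → ℕ) (hk' : ∀ r, k' r = 3 * (2 ^ ℓ - 2 ^ r + 2 ^ (ℓ + 1) * η))
    (s : TruncPoly4 (k + 1))
    (hs : s - (1 + truncX4 (k + 1) ^ 3 + truncX4 (k + 1) ^ 9) ∈
      Ideal.span {truncX4 (k + 1) ^ 10})
    (φ₂ : TruncPoly4 (k + 1) →ₐ[GaloisField 2 2] TruncPoly4 (k + 1))
    (hφ₂ : φ₂ (truncX4 (k + 1)) = s * truncX4 (k + 1))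
    (r : ℕ) (hr : r + 1 ≤ ℓ - 1) :
    truncX4 (k + 1) ^ (k' r) - truncX4 (k + 1) ^ (k' (r + 1)) ∈
      Submodule.span (GaloisField 2 2) {y | ∃ a, y = φ₂ a - a} := by
  set x := truncX4 (k + 1) with hx
  have h2 : (2 : TruncPoly4 (k + 1)) = 0 := by
    have h : (2 : GaloisField 2 2) = 0 := CharP.cast_eq_zero (GaloisField 2 2) 2
    rw [← map_ofNat (algebraMap (GaloisField 2 2) (TruncPoly4 (k + 1))) 2, h, map_zero]
  have hx0 : x ^ (k + 1) = 0 := by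
    rw [hx, ← map_pow]
    exact Ideal.Quotient.eq_zero_iff_mem.mpr (Ideal.mem_span_singleton_self _)
  obtain ⟨c, hc⟩ := Ideal.mem_span_singleton.mp hs
  obtain ⟨z, hz⟩ := pow_two_pow_of_eq_one_add h2 (s := s) (y := x ^ 3)
    ⟨1 + x * c, by linear_combination hc⟩ r
  obtain ⟨n, rfl⟩ : ∃ n, ℓ = r + 2 + n := ⟨ℓ - (r + 2), by omega⟩
  obtain ⟨N, hN⟩ : ∃ N, 2 ^ n = N + 1 := Nat.exists_eq_succ_of_ne_zero (by positivity)
  set q := 2 ^ r with hq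
  have hq1 : 1 ≤ q := Nat.one_le_two_pow
  have hℓq : 2 ^ (r + 2 + n) = 4 * q + 4 * (q * N) := by
    rw [pow_add, pow_add, hN, ← hq]; ring
  obtain ⟨a, ha⟩ : ∃ a, a = N + 2 * (N + 1) * η := ⟨_, rfl⟩
  have hqa : q * a = q * N + 2 * (q * N) * η + 2 * q * η := by rw [ha]; ring
  have hη : 2 ^ (r + 2 + n + 1) * η = 8 * q * η + 8 * (q * N) * η := by
    rw [pow_succ, hℓq]; ring
  obtain ⟨m, hm⟩ : ∃ m, m = q * (4 * (3 * a) + 3) := ⟨_, rfl⟩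
  have hm' : m = 12 * (q * a) + 3 * q := by rw [hm]; ring
  have hkm : k + 3 = m + 9 * q := by
    rw [hℓq, hη] at hk
    rw [hm', hqa]
    ring_nf at hk ⊢
    omega
  have hkr : k' r = m + 6 * q := by
    rw [hk' r, hℓq, hη, hm', hqa, ← hq]
    ring_nf
    omega
  have hkr1 : k' (r + 1) = m + 3 * q := by
    rw [hk' (r + 1), hℓq, hη, hm', hqa, pow_succ, ← hq]
    ring_nf
    omega
  obtain ⟨d, hd⟩ := one_add_pow_four_mul_add_three h2 ((x ^ 3) ^ q) z (3 * a)
  have hsm : s ^ m = 1 + (x ^ 3) ^ q + ((x ^ 3) ^ q) ^ 2 + ((x ^ 3) ^ q) ^ 3 * d := by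
    rw [hm, pow_mul, hz, hd]
  have hvanish : x ^ (m + 9 * q) = 0 := by
    rw [← hkm, show k + 3 = k + 1 + 2 from rfl, pow_add, hx0, zero_mul]
  refine Submodule.subset_span ⟨x ^ m, ?_⟩
  rw [map_pow, hφ₂, mul_pow, hsm, hkr, hkr1]
  linear_combination -x ^ (m + 3 * q) * h2 - d * hvanish
end

section
/- Let F := GaloisField 2 2 be the field with 4 elements. Let ℓ ≥ 2 and let η be any non-negative integer. Set k := 3·(2^ℓ − 1 + 2^{ℓ+1}·η) and k_{ℓ−1} := 3·(2^{ℓ−1} + 2^{ℓ+1}·η). Let A := F[X]/(X^{k+1}) with x the residue class of X. Let ζ ∈ F be a primitive cube root of unity and φ_ζ : A → A an F-algebra homomorphism with φ_ζ(x) = ζ·x. Let t ∈ A be any element with t ≡ 1 + x + x² + x⁴ modulo (x⁵), and let φ₁ : A → A be an F-algebra homomorphism with φ₁(x) = t·x. Then x^{k_{ℓ−1}} lies in the F-submodule of A spanned by the set {σ(a) − a : σ ∈ {φ₁, φ_ζ}, a ∈ A}. -/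
open Polynomial Finset

theorem pow_two_pow_eq_of_two_eq_zero {R : Type*} [CommRing R] (h2 : (2 : R) = 0) {x t u : R}
    (ht : t = 1 + x + x ^ 2 + x ^ 4 + x ^ 5 * u) (n : ℕ) :
    ∃ v, t ^ 2 ^ n = 1 + x ^ 2 ^ n + (x ^ 2 ^ n) ^ 2 + (x ^ 2 ^ n) ^ 4 + (x ^ 2 ^ n) ^ 5 * v := by
  induction n with
  | zero => exact ⟨u, by simpa using ht⟩
  | succ n ih =>
    obtain ⟨v, hv⟩ := ih
    refine ⟨v ^ 2, ?_⟩
    rw [pow_succ 2 n, pow_mul, pow_mul, hv]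
    generalize x ^ 2 ^ n = y
    linear_combination (y + y ^ 2 + y ^ 4 + y ^ 5 * v + y * y ^ 2 + y * y ^ 4 + y * (y ^ 5 * v) +
      y ^ 2 * y ^ 4 + y ^ 2 * (y ^ 5 * v) + y ^ 4 * (y ^ 5 * v)) * h2

theorem exists_pow_four_mul_eq_of_two_eq_zero {R : Type*} [CommRing R] (h2 : (2 : R) = 0)
    {y T v : R} (hT : T = 1 + y + y ^ 2 + y ^ 4 + y ^ 5 * v) (n : ℕ) :
    ∃ r, T ^ (4 * n) = 1 + n * y ^ 4 + y ^ 5 * r := by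
  obtain ⟨w, hw⟩ := pow_two_pow_eq_of_two_eq_zero h2 hT 2
  norm_num at hw
  induction n with
  | zero => exact ⟨0, by simp⟩
  | succ n ih =>
    obtain ⟨r, hr⟩ := ih
    refine ⟨r * T ^ 4 + y ^ 3 * (1 + y ^ 8 + y ^ 12 * w) + n * y ^ 3 * (1 + y ^ 4 + y ^ 12 +
      y ^ 16 * w), ?_⟩
    rw [mul_add, pow_add, hr, mul_one]
    push_cast
    linear_combination (1 + n * y ^ 4) * hw

theorem pow_mem_span_of_map_eq_smul {F A : Type*} [Field F] [CommRing A] [Algebra F A]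
    {S : Set (A →ₐ[F] A)} {φ : A →ₐ[F] A} (hφ : φ ∈ S) {ζ : F} {n : ℕ}
    (hζ : IsPrimitiveRoot ζ n) {x : A} (hx : φ x = ζ • x) {j : ℕ} (hj : ¬ n ∣ j) :
    x ^ j ∈ Submodule.span F {y | ∃ σ ∈ S, ∃ a, y = σ a - a} := by
  have hne : ζ ^ j - 1 ≠ 0 := fun h => hj ((hζ.pow_eq_one_iff_dvd j).1 (sub_eq_zero.1 h))
  rw [← Submodule.smul_mem_iff _ hne]
  refine Submodule.subset_span ⟨φ, hφ, x ^ j, ?_⟩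
  rw [map_pow, hx, _root_.smul_pow, sub_smul, one_smul]

/-- Let `F = 𝔽₄`, `ℓ ≥ 2`, `η ≥ 0`, `k = 3(2^ℓ - 1 + 2^{ℓ+1}η)` and
`k_{ℓ-1} = 3(2^{ℓ-1} + 2^{ℓ+1}η)`.  Let `A = F[X]/(X^{k+1})` with `x` the class of `X`,
`φ_ζ` the algebra map sending `x` to `ζ x` for a primitive cube root of unity `ζ`, and
`φ₁` the algebra map with `φ₁(x) = t·x` where `t ≡ 1 + x + x² + x⁴ mod (x⁵)`.  Then
`x^{k_{ℓ-1}}` lies in the `F`-span of `{σ(a) - a : σ ∈ {φ₁, φ_ζ}, a ∈ A}`. -/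
theorem final_step_two (ℓ : ℕ) (hℓ : 2 ≤ ℓ) (η : ℕ)
    (k : ℕ) (hk : k = 3 * (2 ^ ℓ - 1 + 2 ^ (ℓ + 1) * η))
    (kl : ℕ) (hkl : kl = 3 * (2 ^ (ℓ - 1) + 2 ^ (ℓ + 1) * η))
    (ζ : GaloisField 2 2) (hζ : IsPrimitiveRoot ζ 3)
    (φζ : TruncPoly4 (k + 1) →ₐ[GaloisField 2 2] TruncPoly4 (k + 1))
    (hφζ : φζ (truncX4 (k + 1)) = ζ • truncX4 (k + 1))
    (t : TruncPoly4 (k + 1))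
    (ht : t - (1 + truncX4 (k + 1) + truncX4 (k + 1) ^ 2 + truncX4 (k + 1) ^ 4) ∈
      Ideal.span {truncX4 (k + 1) ^ 5})
    (φ₁ : TruncPoly4 (k + 1) →ₐ[GaloisField 2 2] TruncPoly4 (k + 1))
    (hφ₁ : φ₁ (truncX4 (k + 1)) = t * truncX4 (k + 1)) :
    truncX4 (k + 1) ^ kl ∈
      Submodule.span (GaloisField 2 2)
        {y | ∃ σ ∈ ({φ₁, φζ} : Set (TruncPoly4 (k + 1) →ₐ[GaloisField 2 2] TruncPoly4 (k + 1))),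
          ∃ a, y = σ a - a} := by
  have h2 : (2 : TruncPoly4 (k + 1)) = 0 := by
    have h := congrArg (algebraMap (GaloisField 2 2) (TruncPoly4 (k + 1)))
      (CharTwo.two_eq_zero (R := GaloisField 2 2))
    rwa [map_ofNat, map_zero] at h
  have hx0 : truncX4 (k + 1) ^ (k + 1) = 0 := by
    rw [← map_pow]
    exact Ideal.Quotient.eq_zero_iff_mem.2 (Ideal.mem_span_singleton_self _)
  have hmem : ∀ j, ¬ 3 ∣ j → truncX4 (k + 1) ^ j ∈ Submodule.span (GaloisField 2 2)
      {y | ∃ σ ∈ ({φ₁, φζ} : Set (TruncPoly4 (k + 1) →ₐ[GaloisField 2 2] TruncPoly4 (k + 1))),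
        ∃ a, y = σ a - a} :=
    fun j hj => pow_mem_span_of_map_eq_smul (by simp) hζ hφζ hj
  have himg : φ₁ (truncX4 (k + 1) ^ (2 ^ (ℓ - 1) * (1 + 12 * η))) -
      truncX4 (k + 1) ^ (2 ^ (ℓ - 1) * (1 + 12 * η)) ∈ Submodule.span (GaloisField 2 2)
      {y | ∃ σ ∈ ({φ₁, φζ} : Set (TruncPoly4 (k + 1) →ₐ[GaloisField 2 2] TruncPoly4 (k + 1))),
        ∃ a, y = σ a - a} :=
    Submodule.subset_span ⟨φ₁, by simp, _, rfl⟩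
  obtain ⟨m, rfl⟩ : ∃ m, ℓ = m + 1 := ⟨ℓ - 1, by omega⟩
  rw [Nat.add_sub_cancel] at hkl himg
  generalize truncX4 (k + 1) = x at *
  obtain ⟨u, hu⟩ := Ideal.mem_span_singleton'.1 ht
  obtain ⟨v, hv⟩ := pow_two_pow_eq_of_two_eq_zero h2
    (show t = 1 + x + x ^ 2 + x ^ 4 + x ^ 5 * u by linear_combination -hu) m
  obtain ⟨r, hr⟩ := exists_pow_four_mul_eq_of_two_eq_zero h2 hv (3 * η)
  have hq : ¬ 3 ∣ 2 ^ m := fun h => by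
    have := Nat.prime_three.dvd_of_dvd_pow h
    omega
  have hq0 : 0 < 2 ^ m := by positivity
  simp only [pow_succ] at hk hkl
  obtain ⟨e, he⟩ : ∃ e, e = 2 ^ m * η := ⟨_, rfl⟩
  have hkl' : kl = 3 * 2 ^ m + 12 * e := by rw [hkl, he]; ring
  have hk' : k + 3 = 6 * 2 ^ m + 12 * e := by
    have : 2 ^ m * 2 * 2 * η = 4 * e := by rw [he]; ring
    omega
  have hi : 2 ^ m * (1 + 12 * η) = 2 ^ m + 12 * e := by rw [he]; ring
  have hzero : x ^ (2 ^ m * (1 + 12 * η)) * (x ^ 2 ^ m) ^ 5 = 0 := by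
    rw [← pow_mul, ← pow_add]
    exact pow_eq_zero_of_le (by omega) hx0
  have hexp : φ₁ (x ^ (2 ^ m * (1 + 12 * η))) - x ^ (2 ^ m * (1 + 12 * η)) =
      x ^ (2 * 2 ^ m + 12 * e) + x ^ kl +
        (1 + 3 * η) • x ^ (5 * 2 ^ m + 12 * e) := by
    have h1 : x ^ (2 * 2 ^ m + 12 * e) = x ^ (2 ^ m * (1 + 12 * η)) * x ^ 2 ^ m := by
      rw [← pow_add]; congr 1; omega
    have h3 : x ^ kl = x ^ (2 ^ m * (1 + 12 * η)) * (x ^ 2 ^ m) ^ 2 := by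
      rw [← pow_mul, ← pow_add]; congr 1; omega
    have h4 : x ^ (5 * 2 ^ m + 12 * e) = x ^ (2 ^ m * (1 + 12 * η)) * (x ^ 2 ^ m) ^ 4 := by
      rw [← pow_mul, ← pow_add]; congr 1; omega
    have hT : t ^ (2 ^ m * (1 + 12 * η)) = t ^ 2 ^ m * (t ^ 2 ^ m) ^ (4 * (3 * η)) := by
      rw [← pow_mul, ← pow_add]; congr 1; ring
    rw [map_pow, hφ₁, mul_pow, h1, h3, h4, hT, hr, hv, nsmul_eq_mul]
    generalize x ^ (2 ^ m * (1 + 12 * η)) = z at *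
    generalize x ^ 2 ^ m = y at *
    push_cast
    linear_combination (v + r * (1 + y + y ^ 2 + y ^ 4 + y ^ 5 * v) +
      3 * η * (1 + y + y ^ 3 + y ^ 4 * v)) * hzero
  rw [hexp] at himg
  rw [Submodule.add_mem_iff_left _ (nsmul_mem (hmem _ (by omega)) _),
    Submodule.add_mem_iff_right _ (hmem _ (by omega))] at himg
  exact himg
end

section
/- Let F := GaloisField 2 2 be the field with 4 elements and let k ≥ 2. Let A := F[X]/(X^k) with x the residue class of X. Let ζ ∈ F be a primitive cube root of unity and φ_ζ : A → A an F-algebra homomorphism with φ_ζ(x) = ζ·x. Let t ∈ A be any element with t ≡ 1 + x + x² + x⁴ modulo (x⁵) and φ₁ : A → A an F-algebra homomorphism with φ₁(x) = t·x, and let s ∈ A be any element with s ≡ 1 + x³ + x⁹ modulo (x^{10}) and φ₂ : A → A an F-algebra homomorphism with φ₂(x) = s·x. Then x^{k−1} lies in the F-submodule of A spanned by the set {σ(a) − a : σ ∈ {φ_ζ, φ₁, φ₂}, a ∈ A}. -/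
open Polynomial Finset

section Coinvariants

variable {F A : Type*} [Field F] [CommRing A] [Algebra F A]

/-- The `F`-span of the elements `σ a - a` with `σ` in a set `S` of endomorphisms. -/
def augmentationSpan (S : Set (A →ₐ[F] A)) : Submodule F A :=
  Submodule.span F {y | ∃ σ ∈ S, ∃ a, y = σ a - a}

theorem sub_mem_augmentationSpan {S : Set (A →ₐ[F] A)} {σ : A →ₐ[F] A} (hσ : σ ∈ S) (a : A) :
    σ a - a ∈ augmentationSpan S :=
  Submodule.subset_span ⟨σ, hσ, a, rfl⟩

/-- In characteristic two, `augmentationSpan S` is stable under squaring. -/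
theorem sq_mem_augmentationSpan (h2 : (2 : A) = 0) {S : Set (A →ₐ[F] A)} {a : A}
    (ha : a ∈ augmentationSpan S) : a ^ 2 ∈ augmentationSpan S := by
  induction ha using Submodule.span_induction with
  | mem y hy =>
    obtain ⟨σ, hσ, b, rfl⟩ := hy
    have h : (σ b - b) ^ 2 = σ (b ^ 2) - b ^ 2 := by
      rw [map_pow]
      linear_combination (b ^ 2 - σ b * b) * h2
    rw [h]
    exact sub_mem_augmentationSpan hσ _
  | zero => simp
  | add a b _ _ iha ihb =>
    have h : (a + b) ^ 2 = a ^ 2 + b ^ 2 := by linear_combination a * b * h2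
    rw [h]
    exact add_mem iha ihb
  | smul c a _ iha =>
    rw [_root_.smul_pow]
    exact Submodule.smul_mem _ _ iha

theorem pow_four_mul_eq (h2 : (2 : A) = 0) {t u y : A} (ht : t = 1 + y * u) (r : ℕ) :
    ∃ w, t ^ (4 * r) = 1 + y ^ 4 * w := by
  induction r with
  | zero => exact ⟨0, by simp⟩
  | succ r ih =>
    obtain ⟨w, hw⟩ := ih
    refine ⟨w + u ^ 4 + y ^ 4 * u ^ 4 * w, ?_⟩
    have h4 : t ^ 4 = 1 + y ^ 4 * u ^ 4 := by
      rw [ht]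
      linear_combination (2 * (y * u) + 3 * (y * u) ^ 2 + 2 * (y * u) ^ 3) * h2
    rw [mul_add, pow_add, hw, mul_one, h4]
    ring

/-- If `x ↦ t x` with `t ≡ 1 + x + x² mod x³`, then `x^(m+1) + x^(m+2)` lies in the span
modulo `x^(m+3)` whenever `m ≡ 1 mod 4`. -/
theorem exists_sub_mem_of_one_add_X_add_sq (h2 : (2 : A) = 0) {S : Set (A →ₐ[F] A)}
    {σ : A →ₐ[F] A} (hσ : σ ∈ S) {x t u : A} (hx : σ x = t * x)
    (ht : t = 1 + x + x ^ 2 + x ^ 3 * u) (r : ℕ) :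
    ∃ b, x ^ (4 * r + 2) + x ^ (4 * r + 3) - x ^ (4 * r + 4) * b ∈ augmentationSpan S := by
  obtain ⟨w, hw⟩ := pow_four_mul_eq h2 (y := x) (u := 1 + x + x ^ 2 * u)
    (ht.trans (by ring)) r
  have h := sub_mem_augmentationSpan hσ (x ^ (4 * r + 1))
  rw [map_pow, hx, mul_pow, pow_succ t, hw] at h
  refine ⟨-(u + x * w * t), ?_⟩
  convert h using 1
  linear_combination (-x ^ (4 * r + 1)) * ht

/-- If `x ↦ s x` with `s ≡ 1 + x³ mod x⁷`, then `x^(m+3) + x^(m+6)` lies in the span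
modulo `x^(m+7)` whenever `m ≡ 3 mod 4`. -/
theorem exists_sub_mem_of_one_add_X_cube (h2 : (2 : A) = 0) {S : Set (A →ₐ[F] A)}
    {σ : A →ₐ[F] A} (hσ : σ ∈ S) {x s u : A} (hx : σ x = s * x)
    (hs : s = 1 + x ^ 3 + x ^ 7 * u) (r : ℕ) :
    ∃ b, x ^ (4 * r + 6) + x ^ (4 * r + 9) - x ^ (4 * r + 10) * b ∈ augmentationSpan S := by
  obtain ⟨w, hw⟩ := pow_four_mul_eq h2 (y := x ^ 3) (u := 1 + x ^ 4 * u)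
    (hs.trans (by ring)) r
  have h := sub_mem_augmentationSpan hσ (x ^ (4 * r + 3))
  rw [map_pow, hx, mul_pow, pow_add s, hw] at h
  have h3 : s ^ 3 = 1 + x ^ 3 + x ^ 6 + x ^ 7 *
      (x ^ 2 + 3 * (1 + x ^ 3) ^ 2 * u + 3 * (1 + x ^ 3) * x ^ 7 * u ^ 2 + x ^ 14 * u ^ 3) := by
    rw [hs]
    linear_combination (x ^ 3 + x ^ 6) * h2
  refine ⟨-(x ^ 2 + 3 * (1 + x ^ 3) ^ 2 * u + 3 * (1 + x ^ 3) * x ^ 7 * u ^ 2 + x ^ 14 * u ^ 3 +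
    x ^ 5 * w * s ^ 3), ?_⟩
  convert h using 1
  linear_combination (-x ^ (4 * r + 3)) * h3

theorem pow_mem_augmentationSpan_of_smul {S : Set (A →ₐ[F] A)} {σ : A →ₐ[F] A} (hσ : σ ∈ S)
    {x : A} {ζ : F} (hx : σ x = ζ • x) {n : ℕ} (hn : ζ ^ n ≠ 1) :
    x ^ n ∈ augmentationSpan S := by
  have h := sub_mem_augmentationSpan hσ (x ^ n)
  rw [map_pow, hx, _root_.smul_pow] at h
  replace h : (ζ ^ n - 1) • x ^ n ∈ augmentationSpan S := by rwa [sub_smul, one_smul]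
  exact (Submodule.smul_mem_iff _ (sub_ne_zero.mpr hn)).mp h

/-- Every positive power of `x` lies in the span modulo arbitrarily high powers of `x`. -/
theorem exists_pow_sub_mem_augmentationSpan (h2 : (2 : A) = 0) {S : Set (A →ₐ[F] A)}
    {ρ σ τ : A →ₐ[F] A} (hρ : ρ ∈ S) (hσ : σ ∈ S) (hτ : τ ∈ S) {x t s u v : A} {ζ : F}
    (hA : ∀ a : A, ∃ (c : F) (b : A), a = algebraMap F A c + x * b)
    (hζ : IsPrimitiveRoot ζ 3) (hρx : ρ x = ζ • x)
    (hσx : σ x = t * x) (ht : t = 1 + x + x ^ 2 + x ^ 3 * u)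
    (hτx : τ x = s * x) (hs : s = 1 + x ^ 3 + x ^ 7 * v) (n j : ℕ) (hj : 1 ≤ j) :
    ∃ b, x ^ j - x ^ (n + 1) * b ∈ augmentationSpan S := by
  induction n generalizing j with
  | zero =>
    obtain ⟨i, rfl⟩ := Nat.exists_eq_add_of_le' hj
    exact ⟨x ^ i, by simp [pow_succ']⟩
  | succ n ih =>
    have heven : ∀ i, 1 ≤ i → ∃ b, x ^ (2 * i) - x ^ (n + 2) * b ∈ augmentationSpan S := by
      intro i hi
      obtain ⟨b, hb⟩ := ih i hi
      refine ⟨x ^ n * b ^ 2, ?_⟩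
      convert sq_mem_augmentationSpan h2 hb using 1
      linear_combination (x ^ i * x ^ (n + 1) * b - x ^ (2 * n + 2) * b ^ 2) * h2
    suffices htop : ∃ b, x ^ (n + 1) - x ^ (n + 2) * b ∈ augmentationSpan S by
      obtain ⟨b, hb⟩ := htop
      rcases le_or_gt (n + 2) j with hjn | hjn
      · obtain ⟨i, rfl⟩ := Nat.exists_eq_add_of_le hjn
        exact ⟨x ^ i, by simp [← pow_add]⟩
      obtain ⟨d, hd⟩ := ih j hj
      obtain ⟨c, e, rfl⟩ := hA d
      refine ⟨e + c • b, ?_⟩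
      convert add_mem hd (Submodule.smul_mem _ c hb) using 1
      simp only [Algebra.smul_def]
      ring
    by_cases h3 : 3 ∣ n + 1
    swap
    · refine ⟨0, ?_⟩
      simpa using pow_mem_augmentationSpan_of_smul hρ hρx
        (fun h => h3 ((hζ.pow_eq_one_iff_dvd _).mp h))
    obtain h | h | h : (n + 1) % 2 = 0 ∨ (n + 1) % 4 = 3 ∨ (n + 1) % 4 = 1 := by omega
    · obtain ⟨i, hi⟩ : 2 ∣ n + 1 := Nat.dvd_of_mod_eq_zero h
      rw [hi]
      exact heven i (by omega)
    · obtain ⟨r, rfl⟩ : ∃ r, n = 4 * r + 2 := ⟨n / 4, by omega⟩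
      obtain ⟨b, hb⟩ := exists_sub_mem_of_one_add_X_add_sq h2 hσ hσx ht r
      obtain ⟨c, hc⟩ := heven (2 * r + 1) (by omega)
      refine ⟨b - c, ?_⟩
      convert sub_mem hb hc using 1
      ring
    · obtain ⟨r, rfl⟩ : ∃ r, n = 4 * r + 8 := ⟨n / 4 - 2, by omega⟩
      obtain ⟨b, hb⟩ := exists_sub_mem_of_one_add_X_cube h2 hτ hτx hs r
      obtain ⟨c, hc⟩ := heven (2 * r + 3) (by omega)
      refine ⟨b - c, ?_⟩
      convert sub_mem hb hc using 1
      ring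

end Coinvariants

/-- Let `F = 𝔽₄`, `k ≥ 2` and `A = F[X]/(X^k)` with `x` the class of `X`.  Let `φ_ζ` be
the algebra map sending `x` to `ζ x` for a primitive cube root of unity `ζ`, `φ₁` the
algebra map with `φ₁(x) = t·x` where `t ≡ 1 + x + x² + x⁴ mod (x⁵)`, and `φ₂` the algebra
map with `φ₂(x) = s·x` where `s ≡ 1 + x³ + x⁹ mod (x^{10})`.  Then `x^{k-1}` lies in the
`F`-span of `{σ(a) - a : σ ∈ {φ_ζ, φ₁, φ₂}, a ∈ A}`. -/
theorem key_result_two (k : ℕ) (hk : 2 ≤ k)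
    (ζ : GaloisField 2 2) (hζ : IsPrimitiveRoot ζ 3)
    (φζ : TruncPoly4 k →ₐ[GaloisField 2 2] TruncPoly4 k)
    (hφζ : φζ (truncX4 k) = ζ • truncX4 k)
    (t : TruncPoly4 k)
    (ht : t - (1 + truncX4 k + truncX4 k ^ 2 + truncX4 k ^ 4) ∈
      Ideal.span {truncX4 k ^ 5})
    (φ₁ : TruncPoly4 k →ₐ[GaloisField 2 2] TruncPoly4 k)
    (hφ₁ : φ₁ (truncX4 k) = t * truncX4 k)
    (s : TruncPoly4 k)
    (hs : s - (1 + truncX4 k ^ 3 + truncX4 k ^ 9) ∈ Ideal.span {truncX4 k ^ 10})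
    (φ₂ : TruncPoly4 k →ₐ[GaloisField 2 2] TruncPoly4 k)
    (hφ₂ : φ₂ (truncX4 k) = s * truncX4 k) :
    truncX4 k ^ (k - 1) ∈
      Submodule.span (GaloisField 2 2)
        {y | ∃ σ ∈ ({φζ, φ₁, φ₂} : Set (TruncPoly4 k →ₐ[GaloisField 2 2] TruncPoly4 k)),
          ∃ a, y = σ a - a} := by
  have h2 : (2 : TruncPoly4 k) = 0 := by
    have h : (2 : GaloisField 2 2) = 0 := CharTwo.two_eq_zero
    rw [← map_ofNat (algebraMap (GaloisField 2 2) (TruncPoly4 k)) 2, h, map_zero]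
  have hA : ∀ a : TruncPoly4 k, ∃ (c : GaloisField 2 2) (b : TruncPoly4 k),
      a = algebraMap _ _ c + truncX4 k * b := by
    intro a
    obtain ⟨p, rfl⟩ := Ideal.Quotient.mk_surjective a
    refine ⟨p.coeff 0, Ideal.Quotient.mk _ p.divX, ?_⟩
    conv_lhs => rw [← X_mul_divX_add p, map_add, map_mul, add_comm]
    rfl
  obtain ⟨u, hu⟩ := Ideal.mem_span_singleton'.mp ht
  obtain ⟨v, hv⟩ := Ideal.mem_span_singleton'.mp hs
  obtain ⟨b, hb⟩ := exists_pow_sub_mem_augmentationSpan h2 (S := {φζ, φ₁, φ₂})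
    (u := truncX4 k + truncX4 k ^ 2 * u) (v := truncX4 k ^ 2 + truncX4 k ^ 3 * v)
    (by simp) (by simp) (by simp) hA hζ hφζ hφ₁ (by linear_combination -hu) hφ₂
    (by linear_combination -hv) (k - 1) (k - 1) (by omega)
  have hk0 : truncX4 k ^ (k - 1 + 1) = 0 := by
    rw [Nat.sub_add_cancel (by omega), ← map_pow]
    exact Ideal.Quotient.eq_zero_iff_mem.mpr (Ideal.mem_span_singleton_self _)
  rw [hk0, zero_mul, sub_zero] at hb
  exact hb
end

section
/- For every natural number p ≥ 1 and every natural number j, the number j+1 divides the binomial coefficient C(p·(j+1), j). Consequently the quantity (1/(j+1))·C(p(j+1), j) appearing as a power series coefficient is an integer (a Fuss–Catalan number). -/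
/-- For every `p ≥ 1` and every `j`, the number `j+1` divides the binomial coefficient
`C(p·(j+1), j)`; hence `(1/(j+1))·C(p(j+1), j)` (a Fuss–Catalan number) is an integer. -/
theorem fussCatalan_integer (p j : ℕ) (hp : 1 ≤ p) :
    (j + 1) ∣ Nat.choose (p * (j + 1)) j := by
  have hsub : p * (j + 1) - j = 1 + (p - 1) * (j + 1) := by
    obtain ⟨q, rfl⟩ := Nat.exists_eq_add_of_le' hp
    rw [Nat.add_sub_cancel, add_mul]
    omega
  have hcop : Nat.Coprime (j + 1) (p * (j + 1) - j) := by
    rw [hsub]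
    simp
  refine hcop.dvd_of_dvd_mul_right ?_
  rw [← Nat.choose_succ_right_eq]
  exact dvd_mul_left _ _
end
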